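/- arXiv:2011.03607 — 5 statements merged into one kernel-verified Lean document; each statement's English description precedes it below -/
import Mathlib

section
/- Suppose e = (1 − √(1−θ))·γ for some θ ∈ (0,1). Then trace(H_γ⁻¹ AᵀA H_γ⁻¹) ≤ trace(Ĥ⁻¹ AᵀA Ĥ⁻¹) ≤ (1/(1−θ))·trace(H_γ⁻¹ AᵀA H_γ⁻¹). (These traces are, up to the common factor σ², the traces of the variance of the Frequent Directions ridge regression estimate and of the exact ridge regression solution under the linear model.) -/
open Matrix

namespace Matrix

variable {ι : Type*}

theorem PosSemidef.posDef_add_smul_one [DecidableEq ι] {K : Matrix ι ι ℝ} {γ : ℝ} (hγ : 0 < γ)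
    (hK : K.PosSemidef) : (K + γ • (1 : Matrix ι ι ℝ)).PosDef :=
  PosDef.posSemidef_add hK (PosDef.one.smul hγ)

variable [Fintype ι]

open scoped MatrixOrder in
theorem PosSemidef.trace_mul_nonneg {X Y : Matrix ι ι ℝ}
    (hX : X.PosSemidef) (hY : Y.PosSemidef) : 0 ≤ (X * Y).trace := by
  classical
  obtain ⟨C, rfl⟩ := CStarAlgebra.nonneg_iff_eq_star_mul_self.mp hY.nonneg
  rw [star_eq_conjTranspose, ← Matrix.mul_assoc, trace_mul_comm, ← Matrix.mul_assoc]
  exact (hX.mul_mul_conjTranspose_same C).trace_nonneg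

theorem PosSemidef.conj_of_isHermitian {X S : Matrix ι ι ℝ}
    (hX : X.PosSemidef) (hS : S.IsHermitian) : (S * X * S).PosSemidef := by
  simpa only [hS.eq] using hX.mul_mul_conjTranspose_same S

theorem IsHermitian.posSemidef_mul_self {S : Matrix ι ι ℝ} (hS : S.IsHermitian) :
    (S * S).PosSemidef := by
  simpa only [hS.eq] using posSemidef_self_mul_conjTranspose S

variable [DecidableEq ι]

/-- Squaring is monotone on the order interval between `0` and a scalar matrix. -/
theorem PosSemidef.smul_one_sub_mul_self {E : Matrix ι ι ℝ} {e : ℝ} (he : 0 < e)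
    (hE : E.PosSemidef) (hEe : (e • (1 : Matrix ι ι ℝ) - E).PosSemidef) :
    ((e ^ 2) • (1 : Matrix ι ι ℝ) - E * E).PosSemidef := by
  have h₁ := hEe.conj_of_isHermitian hE.isHermitian
  have h₂ := hE.conj_of_isHermitian hEe.isHermitian
  have h := (hEe.smul he.le).add ((h₁.add h₂).smul (inv_nonneg.mpr he.le))
  convert h using 1
  have : E * (e • (1 : Matrix ι ι ℝ) - E) * E
      + (e • (1 : Matrix ι ι ℝ) - E) * E * (e • (1 : Matrix ι ι ℝ) - E)
      = e • (e • E - E * E) := by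
    simp only [Matrix.mul_sub, Matrix.sub_mul, Matrix.mul_smul, Matrix.smul_mul, Matrix.mul_one,
      Matrix.one_mul, smul_sub, Matrix.mul_assoc]
    abel
  rw [this, inv_smul_smul₀ he.ne', smul_sub, smul_smul, sq]
  abel

/-- The regularized inverse of a positive semidefinite matrix has norm at most `γ⁻¹`. -/
theorem PosSemidef.one_sub_smul_inv_mul_inv {K : Matrix ι ι ℝ} {γ : ℝ} (hγ : 0 < γ)
    (hK : K.PosSemidef) :
    ((1 : Matrix ι ι ℝ) - (γ ^ 2) • ((K + γ • (1 : Matrix ι ι ℝ))⁻¹ *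
      (K + γ • (1 : Matrix ι ι ℝ))⁻¹)).PosSemidef := by
  have hPD := hK.posDef_add_smul_one hγ
  set H := K + γ • (1 : Matrix ι ι ℝ) with hH
  have hu : IsUnit H.det := (isUnit_iff_isUnit_det H).mp hPD.isUnit
  have h := (hK.isHermitian.posSemidef_mul_self.add
    (hK.smul (by positivity : 0 ≤ 2 * γ))).conj_of_isHermitian hPD.inv.isHermitian
  convert h using 1
  have hKK : K * K + (2 * γ) • K = H * H - (γ ^ 2) • (1 : Matrix ι ι ℝ) := by
    rw [hH]
    simp only [Matrix.mul_add, Matrix.add_mul, Matrix.mul_smul, Matrix.smul_mul, Matrix.mul_one,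
      Matrix.one_mul, smul_add, smul_smul]
    module
  have h1 : H⁻¹ * (H * H) * H⁻¹ = 1 := by
    rw [← Matrix.mul_assoc, nonsing_inv_mul _ hu, Matrix.one_mul, mul_nonsing_inv _ hu]
  rw [hKK, Matrix.mul_sub, Matrix.sub_mul, h1]
  simp

/-- If `0 ≤ E ≤ aγ` and `P² ≤ γ⁻²`, then `1 + EP` has norm at most `1 + a`. -/
theorem posSemidef_smul_one_sub_one_add_mul {E P : Matrix ι ι ℝ} {a γ : ℝ} (ha : 0 < a)
    (hγ : 0 < γ) (hP : P.IsHermitian) (hE : E.PosSemidef)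
    (hEe : ((a * γ) • (1 : Matrix ι ι ℝ) - E).PosSemidef)
    (hPγ : ((1 : Matrix ι ι ℝ) - (γ ^ 2) • (P * P)).PosSemidef) :
    (((1 + a) ^ 2) • (1 : Matrix ι ι ℝ) - (1 + E * P) * (1 + P * E)).PosSemidef := by
  have h₁ := hPγ.conj_of_isHermitian hE.isHermitian
  have h₂ := (hE.smul_one_sub_mul_self (mul_pos ha hγ) hEe)
  have hP' : Pᵀ = P := by simpa using hP.eq
  have hE' : Eᵀ = E := by simpa using hE.isHermitian.eq
  have h₃ : ((a • (1 : Matrix ι ι ℝ) - E * P) * (a • (1 : Matrix ι ι ℝ) - P * E)).PosSemidef := by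
    simpa [conjTranspose_sub, conjTranspose_mul, conjTranspose_smul, hP', hE'] using
      posSemidef_self_mul_conjTranspose (a • (1 : Matrix ι ι ℝ) - E * P)
  have h := ((h₁.add h₂).smul (by positivity : 0 ≤ (1 + a⁻¹) * (γ ^ 2)⁻¹)).add
    (h₃.smul (inv_nonneg.mpr ha.le))
  convert h using 1
  simp only [Matrix.mul_sub, Matrix.sub_mul, Matrix.mul_add, Matrix.add_mul, Matrix.mul_smul,
    Matrix.smul_mul, Matrix.mul_one, Matrix.one_mul, smul_sub, smul_add, smul_smul,
    Matrix.mul_assoc]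
  match_scalars <;> field_simp <;> ring

variable {K M : Matrix ι ι ℝ} {γ : ℝ}

theorem trace_ridge_variance_mono (hγ : 0 < γ) (hK : K.PosSemidef) (hM : M.PosSemidef)
    (hMK : (M - K).PosSemidef) :
    ((M + γ • (1 : Matrix ι ι ℝ))⁻¹ * M * (M + γ • (1 : Matrix ι ι ℝ))⁻¹).trace ≤
      ((K + γ • (1 : Matrix ι ι ℝ))⁻¹ * M * (K + γ • (1 : Matrix ι ι ℝ))⁻¹).trace := by
  have hPD := hK.posDef_add_smul_one hγ
  have hQD := hM.posDef_add_smul_one hγ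
  have hKM : M + γ • (1 : Matrix ι ι ℝ) - (K + γ • (1 : Matrix ι ι ℝ)) = M - K := by abel
  set G := K + γ • (1 : Matrix ι ι ℝ)
  set H := M + γ • (1 : Matrix ι ι ℝ) with hH
  have hG : IsUnit G.det := (isUnit_iff_isUnit_det G).mp hPD.isUnit
  have hHu : IsUnit H.det := (isUnit_iff_isUnit_det H).mp hQD.isUnit
  have hQ := hQD.inv.isHermitian
  have e₁ : H⁻¹ * (M - K) * G⁻¹ = G⁻¹ - H⁻¹ := by
    rw [← hKM, Matrix.mul_sub, Matrix.sub_mul, nonsing_inv_mul _ hHu, Matrix.mul_assoc,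
      mul_nonsing_inv _ hG, Matrix.one_mul, Matrix.mul_one]
  have e₂ : G⁻¹ * (M - K) * H⁻¹ = G⁻¹ - H⁻¹ := by
    rw [← hKM, Matrix.mul_sub, Matrix.sub_mul, nonsing_inv_mul _ hG, Matrix.mul_assoc,
      mul_nonsing_inv _ hHu, Matrix.one_mul, Matrix.mul_one]
  have hΔ : (G⁻¹ - H⁻¹).PosSemidef := by
    have h := (hMK.conj_of_isHermitian hQ).add
      ((hPD.inv.posSemidef.conj_of_isHermitian hMK.isHermitian).conj_of_isHermitian hQ)
    convert h using 1
    have : H⁻¹ * ((M - K) * G⁻¹ * (M - K)) * H⁻¹ = H⁻¹ * (M - K) * (G⁻¹ * (M - K) * H⁻¹) := by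
      simp only [Matrix.mul_assoc]
    rw [this, e₂, Matrix.mul_sub (H⁻¹ * (M - K)), e₁]
    abel
  have hMH : M * H = H * M := by
    rw [hH, Matrix.mul_add, Matrix.add_mul]; simp
  have hcomm : M * H⁻¹ = H⁻¹ * M := by
    calc M * H⁻¹ = H⁻¹ * (H * M) * H⁻¹ := by
          rw [← Matrix.mul_assoc, nonsing_inv_mul _ hHu, Matrix.one_mul]
      _ = H⁻¹ * M := by
          rw [← hMH, Matrix.mul_assoc, Matrix.mul_assoc, mul_nonsing_inv _ hHu, Matrix.mul_one]
  have hMQ : (M * H⁻¹).PosSemidef := by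
    have h := (hM.isHermitian.posSemidef_mul_self.add (hM.smul hγ.le)).conj_of_isHermitian hQ
    have : M * M + γ • M = H * M := by rw [hH, Matrix.add_mul]; simp
    rwa [this, ← Matrix.mul_assoc, nonsing_inv_mul _ hHu, Matrix.one_mul] at h
  have t₁ := hMQ.trace_mul_nonneg hΔ
  have t₂ := (hM.conj_of_isHermitian hΔ.isHermitian).trace_nonneg
  set D := G⁻¹ - H⁻¹
  have hGD : G⁻¹ = H⁻¹ + D := by simp [D]
  have t₃ : (H⁻¹ * M * D).trace = (M * H⁻¹ * D).trace := by rw [hcomm]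
  have t₄ : (D * M * H⁻¹).trace = (M * H⁻¹ * D).trace := by
    rw [Matrix.mul_assoc, trace_mul_comm]
  rw [hGD]
  simp only [Matrix.mul_add, Matrix.add_mul, trace_add]
  linarith

theorem trace_ridge_variance_le (hγ : 0 < γ) (hK : K.PosSemidef) (hM : M.PosSemidef)
    (hMK : (M - K).PosSemidef) {a : ℝ} (ha : 0 < a)
    (hMKa : ((a * γ) • (1 : Matrix ι ι ℝ) - (M - K)).PosSemidef) :
    ((K + γ • (1 : Matrix ι ι ℝ))⁻¹ * M * (K + γ • (1 : Matrix ι ι ℝ))⁻¹).trace ≤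
      (1 + a) ^ 2 *
        ((M + γ • (1 : Matrix ι ι ℝ))⁻¹ * M * (M + γ • (1 : Matrix ι ι ℝ))⁻¹).trace := by
  have hPD := hK.posDef_add_smul_one hγ
  have hQD := hM.posDef_add_smul_one hγ
  have hW := posSemidef_smul_one_sub_one_add_mul ha hγ hPD.inv.isHermitian hMK hMKa
    (hK.one_sub_smul_inv_mul_inv hγ)
  have hKM : M - K = M + γ • (1 : Matrix ι ι ℝ) - (K + γ • (1 : Matrix ι ι ℝ)) := by abel
  set G := K + γ • (1 : Matrix ι ι ℝ)
  set H := M + γ • (1 : Matrix ι ι ℝ)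
  have hG : IsUnit G.det := (isUnit_iff_isUnit_det G).mp hPD.isUnit
  have hHu : IsUnit H.det := (isUnit_iff_isUnit_det H).mp hQD.isUnit
  have e₁ : 1 + (M - K) * G⁻¹ = H * G⁻¹ := by
    rw [hKM, Matrix.sub_mul, mul_nonsing_inv _ hG]; abel
  have e₂ : 1 + G⁻¹ * (M - K) = G⁻¹ * H := by
    rw [hKM, Matrix.mul_sub, nonsing_inv_mul _ hG]; abel
  rw [e₁, e₂] at hW
  have t := (hM.conj_of_isHermitian hQD.inv.isHermitian).trace_mul_nonneg hW
  have hf : (H⁻¹ * M * H⁻¹ * (H * G⁻¹ * (G⁻¹ * H))).trace = (G⁻¹ * M * G⁻¹).trace := by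
    calc _ = (H⁻¹ * (M * ((H⁻¹ * H) * (G⁻¹ * G⁻¹ * H)))).trace := by
          simp only [Matrix.mul_assoc]
      _ = (M * (G⁻¹ * G⁻¹) * (H * H⁻¹)).trace := by
          rw [nonsing_inv_mul _ hHu, Matrix.one_mul, trace_mul_comm]
          simp only [Matrix.mul_assoc]
      _ = _ := by
          rw [mul_nonsing_inv _ hHu, Matrix.mul_one, ← Matrix.mul_assoc, trace_mul_comm,
            Matrix.mul_assoc]
  rw [Matrix.mul_sub, trace_sub, hf, Matrix.mul_smul, Matrix.mul_one, trace_smul,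
    smul_eq_mul] at t
  linarith

end Matrix

/-- Variance (trace) bound for Frequent Directions ridge regression:
if `e = (1 − √(1−θ))·γ` with `θ ∈ (0,1)`, then
`trace(H_γ⁻¹AᵀAH_γ⁻¹) ≤ trace(Ĥ⁻¹AᵀAĤ⁻¹) ≤ (1/(1−θ))·trace(H_γ⁻¹AᵀAH_γ⁻¹)`. -/
theorem fd_ridge_variance_bound
    {n m d : ℕ} (A : Matrix (Fin n) (Fin d) ℝ) (B : Matrix (Fin m) (Fin d) ℝ)
    (γ θ e : ℝ) (hγ : 0 < γ) (hθ : θ ∈ Set.Ioo (0 : ℝ) 1)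
    (he : e = (1 - Real.sqrt (1 - θ)) * γ)
    (hFD₁ : (Bᵀ * B - (Aᵀ * A - e • (1 : Matrix (Fin d) (Fin d) ℝ))).PosSemidef)
    (hFD₂ : (Aᵀ * A - Bᵀ * B).PosSemidef) :
    ((Aᵀ * A + γ • (1 : Matrix (Fin d) (Fin d) ℝ))⁻¹ * (Aᵀ * A) *
          (Aᵀ * A + γ • (1 : Matrix (Fin d) (Fin d) ℝ))⁻¹).trace
        ≤ ((Bᵀ * B + γ • (1 : Matrix (Fin d) (Fin d) ℝ))⁻¹ * (Aᵀ * A) *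
            (Bᵀ * B + γ • (1 : Matrix (Fin d) (Fin d) ℝ))⁻¹).trace ∧
      ((Bᵀ * B + γ • (1 : Matrix (Fin d) (Fin d) ℝ))⁻¹ * (Aᵀ * A) *
          (Bᵀ * B + γ • (1 : Matrix (Fin d) (Fin d) ℝ))⁻¹).trace
        ≤ (1 / (1 - θ)) *
            ((Aᵀ * A + γ • (1 : Matrix (Fin d) (Fin d) ℝ))⁻¹ * (Aᵀ * A) *
              (Aᵀ * A + γ • (1 : Matrix (Fin d) (Fin d) ℝ))⁻¹).trace := by
  have hM : (Aᵀ * A).PosSemidef := by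
    simpa using posSemidef_conjTranspose_mul_self A
  have hK : (Bᵀ * B).PosSemidef := by
    simpa using posSemidef_conjTranspose_mul_self B
  refine ⟨trace_ridge_variance_mono hγ hK hM hFD₂, ?_⟩
  obtain ⟨hθ0, hθ1⟩ := hθ
  set s := Real.sqrt (1 - θ) with hs
  have hs0 : 0 < s := Real.sqrt_pos.mpr (by linarith)
  have hsq : s ^ 2 = 1 - θ := Real.sq_sqrt (by linarith)
  have hs1 : s < 1 := by nlinarith
  have hE : (((1 - s) * γ) • (1 : Matrix (Fin d) (Fin d) ℝ) - (Aᵀ * A - Bᵀ * B)).PosSemidef := by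
    rw [← he]
    convert hFD₁ using 1
    abel
  refine (trace_ridge_variance_le hγ hK hM hFD₂ (sub_pos.mpr hs1) hE).trans ?_
  refine mul_le_mul_of_nonneg_right ?_
    (hM.conj_of_isHermitian (hM.posDef_add_smul_one hγ).inv.isHermitian).trace_nonneg
  rw [← hsq, le_div_iff₀ (by positivity), ← mul_pow]
  exact pow_le_one₀ (by nlinarith) (by nlinarith [sq_nonneg (1 - s)])
end

section
/- If 2e < γ, then the ℓ2→ℓ2 operator norm of I_d − Ĥ⁻¹H_γ satisfies ‖I_d − Ĥ⁻¹H_γ‖ ≤ e/(γ − e) < 1. -/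
open Matrix

/-- Cauchy–Schwarz for the quadratic form of a positive semidefinite matrix bounded by `e`. -/
lemma Matrix.PosSemidef.sq_dotProduct_mulVec_le {ι : Type*} [Fintype ι] {D : Matrix ι ι ℝ}
    (hD : D.PosSemidef) {e : ℝ} (hDe : ∀ v : ι → ℝ, v ⬝ᵥ D *ᵥ v ≤ e * (v ⬝ᵥ v))
    (x y : ι → ℝ) : (y ⬝ᵥ D *ᵥ x) ^ 2 ≤ (e * (y ⬝ᵥ y)) * (e * (x ⬝ᵥ x)) := by
  have nonneg (v : ι → ℝ) : 0 ≤ v ⬝ᵥ D *ᵥ v := by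
    simpa using hD.dotProduct_mulVec_nonneg v
  have symm : x ⬝ᵥ D *ᵥ y = y ⬝ᵥ D *ᵥ x := by
    have hT : Dᵀ = D := by simpa using hD.isHermitian.eq
    rw [dotProduct_comm, ← vecMul_transpose, hT, dotProduct_mulVec]
  have key : discrim (y ⬝ᵥ D *ᵥ y) (2 * (y ⬝ᵥ D *ᵥ x)) (x ⬝ᵥ D *ᵥ x) ≤ 0 := by
    refine discrim_le_zero fun t => ?_
    have h := nonneg (x + t • y)
    simp only [mulVec_add, mulVec_smul, add_dotProduct, dotProduct_add, smul_dotProduct,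
      dotProduct_smul, smul_eq_mul, symm] at h
    linarith
  have hmul := mul_le_mul (hDe y) (hDe x) (nonneg x) ((nonneg y).trans (hDe y))
  rw [discrim] at key
  linarith

/-- If `2e < γ`, then the ℓ²→ℓ² operator norm of `I − Ĥ⁻¹H_γ`
satisfies `‖I − Ĥ⁻¹H_γ‖ ≤ e/(γ − e) < 1`. -/
theorem fd_iteration_contraction
    {n m d : ℕ} (A : Matrix (Fin n) (Fin d) ℝ) (B : Matrix (Fin m) (Fin d) ℝ)
    (γ e : ℝ) (hγ : 0 < γ) (he0 : 0 ≤ e) (he : 2 * e < γ)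
    (hFD₁ : (Bᵀ * B - (Aᵀ * A - e • (1 : Matrix (Fin d) (Fin d) ℝ))).PosSemidef)
    (hFD₂ : (Aᵀ * A - Bᵀ * B).PosSemidef) :
    ‖Matrix.toEuclideanCLM (𝕜 := ℝ)
        ((1 : Matrix (Fin d) (Fin d) ℝ) -
          (Bᵀ * B + γ • (1 : Matrix (Fin d) (Fin d) ℝ))⁻¹ *
            (Aᵀ * A + γ • (1 : Matrix (Fin d) (Fin d) ℝ)))‖ ≤ e / (γ - e) ∧
      e / (γ - e) < 1 := by
  have hlt : e / (γ - e) < 1 := by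
    rw [div_lt_one (by linarith)]
    linarith
  refine ⟨?_, hlt⟩
  have hB : (Bᵀ * B).PosSemidef := by
    simpa using posSemidef_conjTranspose_mul_self B
  have hH : (Bᵀ * B + γ • (1 : Matrix (Fin d) (Fin d) ℝ)).PosDef :=
    PosDef.posSemidef_add hB (PosDef.one.smul hγ)
  set D := Aᵀ * A - Bᵀ * B with hDdef
  set H := Bᵀ * B + γ • (1 : Matrix (Fin d) (Fin d) ℝ) with hHdef
  have hHu : IsUnit H.det := (isUnit_iff_isUnit_det H).mp hH.isUnit
  have hM : 1 - H⁻¹ * (Aᵀ * A + γ • (1 : Matrix (Fin d) (Fin d) ℝ)) = -(H⁻¹ * D) := by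
    have hsum : Aᵀ * A + γ • (1 : Matrix (Fin d) (Fin d) ℝ) = H + D := by
      rw [hHdef, hDdef]
      abel
    rw [hsum, mul_add, nonsing_inv_mul _ hHu]
    abel
  have hDe (v : Fin d → ℝ) : v ⬝ᵥ D *ᵥ v ≤ e * (v ⬝ᵥ v) := by
    have h := hFD₁.dotProduct_mulVec_nonneg v
    have hED : Bᵀ * B - (Aᵀ * A - e • (1 : Matrix (Fin d) (Fin d) ℝ)) = e • 1 - D := by
      rw [hDdef]
      abel
    rw [hED] at h
    simp only [star_trivial, sub_mulVec, smul_mulVec, one_mulVec, dotProduct_sub,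
      dotProduct_smul, smul_eq_mul] at h
    linarith
  have hγH (v : Fin d → ℝ) : γ * (v ⬝ᵥ v) ≤ v ⬝ᵥ H *ᵥ v := by
    have h := hB.dotProduct_mulVec_nonneg v
    simp only [star_trivial] at h
    simp only [hHdef, add_mulVec, smul_mulVec, one_mulVec, dotProduct_add,
      dotProduct_smul, smul_eq_mul]
    linarith
  have hnorm (v : EuclideanSpace ℝ (Fin d)) : v.ofLp ⬝ᵥ v.ofLp = ‖v‖ ^ 2 := by
    rw [EuclideanSpace.real_norm_sq_eq]
    simp [dotProduct, sq]
  have hle : e / γ ≤ e / (γ - e) :=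
    div_le_div_of_nonneg_left he0 (by linarith) (by linarith)
  rw [hM, map_neg, norm_neg]
  refine le_trans (ContinuousLinearMap.opNorm_le_bound _ (by positivity) fun x => ?_) hle
  set y := toEuclideanCLM (𝕜 := ℝ) (H⁻¹ * D) x with hy
  have hHy : H *ᵥ y.ofLp = D *ᵥ x.ofLp := by
    rw [hy, ofLp_toEuclideanCLM, mulVec_mulVec, mul_nonsing_inv_cancel_left _ _ hHu]
  have hlow := hγH y.ofLp
  have hup := hFD₂.sq_dotProduct_mulVec_le hDe x.ofLp y.ofLp
  rw [hHy] at hlow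
  rw [hnorm] at hlow hup
  rw [hnorm] at hup
  have habs : y.ofLp ⬝ᵥ D *ᵥ x.ofLp ≤ e * ‖y‖ * ‖x‖ :=
    abs_le_of_sq_le_sq' (by linarith) (by positivity) |>.2
  rw [div_mul_eq_mul_div, le_div_iff₀ hγ]
  rcases (norm_nonneg y).eq_or_lt with h0 | hpos
  · rw [← h0, zero_mul]
    positivity
  · refine le_of_mul_le_mul_left ?_ hpos
    linarith
end

section
/- Suppose e = b·γ with b ∈ (0, 1/2). Let b ∈ ℝⁿ be any vector (the target vector of the regression), let x* = H_γ⁻¹Aᵀb be the exact ridge regression solution, and define iterates x⁽⁰⁾ = 0 and x⁽ᵗ⁺¹⁾ = x⁽ᵗ⁾ − Ĥ⁻¹·((AᵀA + γI_d)x⁽ᵗ⁾ − Aᵀb). Then for every t ≥ 0, ‖x⁽ᵗ⁾ − x*‖₂ ≤ (b/(1−b))ᵗ · ‖x*‖₂. -/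
open Matrix

/-- Euclidean (ℓ²) norm on `ℝ^d`. -/
noncomputable def eNorm {d : ℕ} (x : Fin d → ℝ) : ℝ :=
  ‖(WithLp.equiv 2 (Fin d → ℝ)).symm x‖

theorem eNorm_nonneg {d : ℕ} (x : Fin d → ℝ) : 0 ≤ eNorm x := norm_nonneg _

theorem eNorm_sq {d : ℕ} (x : Fin d → ℝ) : eNorm x ^ 2 = x ⬝ᵥ x := by
  simp [eNorm, EuclideanSpace.norm_sq_eq, dotProduct, ← pow_two]

theorem eNorm_neg {d : ℕ} (x : Fin d → ℝ) : eNorm (-x) = eNorm x := by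
  rw [← sq_eq_sq₀ (eNorm_nonneg _) (eNorm_nonneg _), eNorm_sq, eNorm_sq, neg_dotProduct_neg]

theorem posDef_transpose_mul_self_add_smul_one {m d : ℕ} (A : Matrix (Fin m) (Fin d) ℝ)
    {γ : ℝ} (hγ : 0 < γ) : (Aᵀ * A + γ • (1 : Matrix (Fin d) (Fin d) ℝ)).PosDef := by
  have h := posSemidef_conjTranspose_mul_self A
  rw [conjTranspose_eq_transpose_of_trivial] at h
  exact PosDef.posSemidef_add h (PosDef.one.smul hγ)

/-- If `G` and `D` are positive semidefinite with `D ⪯ bγ·I` and `(G + γ·I) z = -D v`, then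
`‖z‖ ≤ b‖v‖`. -/
theorem eNorm_le_of_add_smul_mulVec_eq_neg {d : ℕ} {G D : Matrix (Fin d) (Fin d) ℝ} {γ b : ℝ}
    (hγ : 0 < γ) (hb : 0 < b) (hG : G.PosSemidef) (hD : D.PosSemidef)
    (hDb : ((b * γ) • (1 : Matrix (Fin d) (Fin d) ℝ) - D).PosSemidef) {z v : Fin d → ℝ}
    (hz : (G + γ • (1 : Matrix (Fin d) (Fin d) ℝ)) *ᵥ z = -(D *ᵥ v)) :
    eNorm z ≤ b * eNorm v := by
  have hGz : 0 ≤ z ⬝ᵥ G *ᵥ z := by simpa using hG.dotProduct_mulVec_nonneg z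
  have hDzv : 0 ≤ (z + b • v) ⬝ᵥ D *ᵥ (z + b • v) := by
    simpa using hD.dotProduct_mulVec_nonneg (z + b • v)
  have hDz : 0 ≤ z ⬝ᵥ ((b * γ) • (1 : Matrix (Fin d) (Fin d) ℝ) - D) *ᵥ z := by
    simpa using hDb.dotProduct_mulVec_nonneg z
  have hDv : 0 ≤ v ⬝ᵥ ((b * γ) • (1 : Matrix (Fin d) (Fin d) ℝ) - D) *ᵥ v := by
    simpa using hDb.dotProduct_mulVec_nonneg v
  have hzz := congrArg (z ⬝ᵥ ·) hz
  have hsymm : v ⬝ᵥ D *ᵥ z = z ⬝ᵥ D *ᵥ v := by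
    have hDt : Dᵀ = D := by
      simpa [conjTranspose_eq_transpose_of_trivial] using hD.isHermitian.eq
    rw [dotProduct_mulVec, ← mulVec_transpose, hDt, dotProduct_comm]
  simp only [add_mulVec, sub_mulVec, smul_mulVec, one_mulVec, mulVec_add, mulVec_smul,
    dotProduct_add, add_dotProduct, dotProduct_sub, dotProduct_smul, smul_dotProduct,
    dotProduct_neg, smul_eq_mul, hsymm, ← eNorm_sq] at hzz hDzv hDz hDv
  refine abs_le_of_sq_le_sq' ?_ (mul_nonneg hb.le (eNorm_nonneg v)) |>.2
  have hbγ : 0 < b * γ := mul_pos hb hγ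
  refine le_of_mul_le_mul_left ?_ hbγ
  nlinarith [mul_nonneg hb.le hGz, mul_nonneg (mul_nonneg hb.le hb.le) hDv]

/-- Convergence of iterative Frequent Directions ridge regression:
if `e = b·γ` with `b ∈ (0,1/2)`, `x⁽⁰⁾ = 0` and
`x⁽ᵗ⁺¹⁾ = x⁽ᵗ⁾ − Ĥ⁻¹((AᵀA + γI)x⁽ᵗ⁾ − Aᵀy)`, then
`‖x⁽ᵗ⁾ − x*‖ ≤ (b/(1−b))ᵗ‖x*‖` where `x* = H_γ⁻¹Aᵀy`. -/
theorem fd_iterative_convergence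
    {n m d : ℕ} (A : Matrix (Fin n) (Fin d) ℝ) (B : Matrix (Fin m) (Fin d) ℝ)
    (γ e b : ℝ) (hγ : 0 < γ) (hb : b ∈ Set.Ioo (0 : ℝ) (1 / 2)) (he : e = b * γ)
    (hFD₁ : (Bᵀ * B - (Aᵀ * A - e • (1 : Matrix (Fin d) (Fin d) ℝ))).PosSemidef)
    (hFD₂ : (Aᵀ * A - Bᵀ * B).PosSemidef)
    (y : Fin n → ℝ) (x : ℕ → Fin d → ℝ)
    (hx0 : x 0 = 0)
    (hxstep : ∀ t, x (t + 1) = x t -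
        (Bᵀ * B + γ • (1 : Matrix (Fin d) (Fin d) ℝ))⁻¹ *ᵥ
          ((Aᵀ * A + γ • (1 : Matrix (Fin d) (Fin d) ℝ)) *ᵥ x t - Aᵀ *ᵥ y)) :
    ∀ t : ℕ,
      eNorm (x t - (Aᵀ * A + γ • (1 : Matrix (Fin d) (Fin d) ℝ))⁻¹ *ᵥ (Aᵀ *ᵥ y))
        ≤ (b / (1 - b)) ^ t *
            eNorm ((Aᵀ * A + γ • (1 : Matrix (Fin d) (Fin d) ℝ))⁻¹ *ᵥ (Aᵀ *ᵥ y)) := by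
  set H := Aᵀ * A + γ • (1 : Matrix (Fin d) (Fin d) ℝ) with hH
  set K := Bᵀ * B + γ • (1 : Matrix (Fin d) (Fin d) ℝ) with hK
  set s := H⁻¹ *ᵥ (Aᵀ *ᵥ y) with hs
  obtain ⟨hb0, hb1⟩ := hb
  have hHu : IsUnit H.det :=
    (isUnit_iff_isUnit_det _).1 (posDef_transpose_mul_self_add_smul_one A hγ).isUnit
  have hKu : IsUnit K.det :=
    (isUnit_iff_isUnit_det _).1 (posDef_transpose_mul_self_add_smul_one B hγ).isUnit
  have hHs : H *ᵥ s = Aᵀ *ᵥ y := by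
    rw [hs, mulVec_mulVec, mul_nonsing_inv _ hHu, one_mulVec]
  have hG : (Bᵀ * B).PosSemidef := by
    simpa [conjTranspose_eq_transpose_of_trivial] using posSemidef_conjTranspose_mul_self B
  have hDb : ((b * γ) • (1 : Matrix (Fin d) (Fin d) ℝ) - (Aᵀ * A - Bᵀ * B)).PosSemidef := by
    convert hFD₁ using 1
    rw [he]
    abel
  have hcontract : ∀ t, eNorm (x (t + 1) - s) ≤ b * eNorm (x t - s) := by
    intro t
    refine eNorm_le_of_add_smul_mulVec_eq_neg hγ hb0 hG hFD₂ hDb ?_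
    have hHK : Aᵀ * A - Bᵀ * B = H - K := by rw [hH, hK]; abel
    rw [← hK, hHK, hxstep t, ← hHs, ← mulVec_sub, sub_right_comm, mulVec_sub K,
      mulVec_mulVec _ K, mul_nonsing_inv _ hKu, one_mulVec, sub_mulVec, neg_sub]
  have hb_le : b ≤ b / (1 - b) := by
    rw [le_div_iff₀ (by linarith)]
    nlinarith
  intro t
  induction t with
  | zero => simp [hx0, eNorm_neg]
  | succ t ih =>
    calc eNorm (x (t + 1) - s) ≤ b * eNorm (x t - s) := hcontract t
      _ ≤ b / (1 - b) * ((b / (1 - b)) ^ t * eNorm s) :=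
        mul_le_mul hb_le ih (eNorm_nonneg _) (hb0.le.trans hb_le)
      _ = (b / (1 - b)) ^ (t + 1) * eNorm s := by ring
end

section
/- If e < γ, then the ℓ2→ℓ2 operator norm of I_d − Ĥ⁻¹H_γ satisfies ‖I_d − Ĥ⁻¹H_γ‖ ≤ e/(2γ − e) < 1, where Ĥ = BᵀB + (δ+γ)·I_d. -/
open Matrix

/-- A symmetric real matrix lying between `0` and `c • 1` in the Löwner order has
operator norm at most `c`. -/
lemma norm_toEuclideanCLM_le_of_posSemidef {ι : Type*} [Fintype ι] [DecidableEq ι]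
    {M : Matrix ι ι ℝ} {c : ℝ} (hM : M.PosSemidef) (hc : 0 ≤ c)
    (hMc : (c • (1 : Matrix ι ι ℝ) - M).PosSemidef) :
    ‖Matrix.toEuclideanCLM (𝕜 := ℝ) M‖ ≤ c := by
  have hsymm : (Matrix.toEuclideanCLM (𝕜 := ℝ) M).IsSymmetric :=
    (isPositive_toEuclideanLin_iff.2 hM).isSymmetric
  rw [ContinuousLinearMap.norm_eq_iSup_rayleighQuotient _ hsymm]
  refine ciSup_le fun x => ?_
  have hpos : 0 ≤ inner ℝ x (Matrix.toEuclideanCLM (𝕜 := ℝ) M x) :=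
    (isPositive_toEuclideanLin_iff.2 hM).inner_nonneg_right x
  have hle : 0 ≤ inner ℝ x (Matrix.toEuclideanCLM (𝕜 := ℝ) (c • (1 : Matrix ι ι ℝ) - M) x) :=
    (isPositive_toEuclideanLin_iff.2 hMc).inner_nonneg_right x
  rw [map_sub, map_smul, map_one] at hle
  simp only [_root_.sub_apply, _root_.smul_apply,
    one_apply_eq_self, inner_sub_right, real_inner_smul_right,
    real_inner_self_eq_norm_sq] at hle
  rw [ContinuousLinearMap.rayleighQuotient, ContinuousLinearMap.reApplyInnerSelf_apply,
    RCLike.re_to_real, real_inner_comm, abs_of_nonneg (by positivity)]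
  exact div_le_of_le_mul₀ (by positivity) hc (by linarith)

/-- If `c • 1 ⪯ M` with `c > 0`, then the operator norm of `M⁻¹` is at most `c⁻¹`. -/
lemma norm_toEuclideanCLM_inv_le {ι : Type*} [Fintype ι] [DecidableEq ι]
    {M : Matrix ι ι ℝ} {c : ℝ} (hc : 0 < c) (hM : IsUnit M.det)
    (hMc : (M - c • (1 : Matrix ι ι ℝ)).PosSemidef) :
    ‖Matrix.toEuclideanCLM (𝕜 := ℝ) M⁻¹‖ ≤ c⁻¹ := by
  refine ContinuousLinearMap.opNorm_le_bound _ (by positivity) fun x => ?_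
  set y := Matrix.toEuclideanCLM (𝕜 := ℝ) M⁻¹ x with hy
  have hx : Matrix.toEuclideanCLM (𝕜 := ℝ) M y = x := by
    rw [hy, ← mul_apply_eq_comp, ← map_mul, mul_nonsing_inv _ hM, map_one,
      one_apply_eq_self]
  have hle : 0 ≤ inner ℝ y (Matrix.toEuclideanCLM (𝕜 := ℝ) (M - c • (1 : Matrix ι ι ℝ)) y) :=
    (isPositive_toEuclideanLin_iff.2 hMc).inner_nonneg_right y
  rw [map_sub, map_smul, map_one] at hle
  simp only [_root_.sub_apply, _root_.smul_apply,
    one_apply_eq_self, inner_sub_right, real_inner_smul_right,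
    real_inner_self_eq_norm_sq, hx] at hle
  have hcs : inner ℝ y x ≤ ‖y‖ * ‖x‖ := real_inner_le_norm y x
  rw [inv_mul_eq_div, le_div_iff₀ hc]
  rcases (norm_nonneg y).eq_or_lt with h0 | h0
  · simp [← h0]
  · exact le_of_mul_le_mul_left (by linarith) h0

/-- Robust Frequent Directions contraction: if `e < γ`, then the
ℓ²→ℓ² operator norm of `I − Ĥ⁻¹H_γ` (with `Ĥ = BᵀB + (δ+γ)I`) satisfies
`‖I − Ĥ⁻¹H_γ‖ ≤ e/(2γ − e) < 1`. -/
theorem rfd_iteration_contraction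
    {n m d : ℕ} (A : Matrix (Fin n) (Fin d) ℝ) (B : Matrix (Fin m) (Fin d) ℝ)
    (γ e δ : ℝ) (hγ : 0 < γ) (he0 : 0 ≤ e) (hδ : 0 ≤ δ) (he : e < γ)
    (hRFD₁ : ((Bᵀ * B + δ • (1 : Matrix (Fin d) (Fin d) ℝ)) -
        (Aᵀ * A - (e / 2) • (1 : Matrix (Fin d) (Fin d) ℝ))).PosSemidef)
    (hRFD₂ : (Aᵀ * A - (Bᵀ * B + δ • (1 : Matrix (Fin d) (Fin d) ℝ))).PosSemidef) :
    ‖Matrix.toEuclideanCLM (𝕜 := ℝ)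
        ((1 : Matrix (Fin d) (Fin d) ℝ) -
          (Bᵀ * B + (δ + γ) • (1 : Matrix (Fin d) (Fin d) ℝ))⁻¹ *
            (Aᵀ * A + γ • (1 : Matrix (Fin d) (Fin d) ℝ)))‖ ≤ e / (2 * γ - e) ∧
      e / (2 * γ - e) < 1 := by
  have hden : 0 < 2 * γ - e := by linarith
  refine ⟨?_, by rw [div_lt_one hden]; linarith⟩
  have hB : (Bᵀ * B).PosSemidef := by
    simpa using posSemidef_conjTranspose_mul_self B
  have hposDef : (Bᵀ * B + (δ + γ) • (1 : Matrix (Fin d) (Fin d) ℝ)).PosDef :=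
    PosDef.posSemidef_add hB (PosDef.one.smul (by linarith))
  have hdet := hposDef.det_pos.ne'.isUnit
  have hlower : (Bᵀ * B + (δ + γ) • (1 : Matrix (Fin d) (Fin d) ℝ) -
      γ • (1 : Matrix (Fin d) (Fin d) ℝ)).PosSemidef := by
    convert! hB.add (PosSemidef.one.smul hδ) using 1
    module
  have hupper : ((e / 2) • (1 : Matrix (Fin d) (Fin d) ℝ) -
      (Aᵀ * A - (Bᵀ * B + δ • (1 : Matrix (Fin d) (Fin d) ℝ)))).PosSemidef := by
    convert! hRFD₁ using 1
    abel
  have hfactor : (1 : Matrix (Fin d) (Fin d) ℝ) -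
      (Bᵀ * B + (δ + γ) • (1 : Matrix (Fin d) (Fin d) ℝ))⁻¹ *
        (Aᵀ * A + γ • (1 : Matrix (Fin d) (Fin d) ℝ)) =
      -((Bᵀ * B + (δ + γ) • (1 : Matrix (Fin d) (Fin d) ℝ))⁻¹ *
        (Aᵀ * A - (Bᵀ * B + δ • (1 : Matrix (Fin d) (Fin d) ℝ)))) := by
    have hsplit : Aᵀ * A + γ • (1 : Matrix (Fin d) (Fin d) ℝ) =
        (Bᵀ * B + (δ + γ) • (1 : Matrix (Fin d) (Fin d) ℝ)) +
          (Aᵀ * A - (Bᵀ * B + δ • (1 : Matrix (Fin d) (Fin d) ℝ))) := by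
      module
    rw [hsplit, mul_add, nonsing_inv_mul _ hdet]
    abel
  rw [hfactor, map_neg, norm_neg, map_mul]
  calc _ ≤ γ⁻¹ * (e / 2) :=
        (norm_mul_le _ _).trans (mul_le_mul (norm_toEuclideanCLM_inv_le hγ hdet hlower)
          (norm_toEuclideanCLM_le_of_posSemidef hRFD₂ (by linarith) hupper)
          (norm_nonneg _) (by positivity))
    _ = e / (2 * γ) := by field_simp
    _ ≤ e / (2 * γ - e) := div_le_div_of_nonneg_left he0 hden (by linarith)
end

section
/- Let γ' = γ − e and assume γ' > 0. Then, in the Löwner order, (AᵀA + γ·I_d)⁻¹ ⪯ (BᵀB + γ·I_d)⁻¹ ⪯ (γ/γ')·(AᵀA + γ·I_d)⁻¹. -/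
open Matrix

/-- Inversion is antitone on positive definite matrices for the Löwner order. -/
theorem Matrix.PosDef.posSemidef_inv_sub_inv {ι : Type*} [Fintype ι] [DecidableEq ι]
    {P Q : Matrix ι ι ℝ} (hP : P.PosDef) (hPQ : (Q - P).PosSemidef) :
    (P⁻¹ - Q⁻¹).PosSemidef := by
  have hQ : Q.PosDef := by simpa using hP.add_posSemidef hPQ
  have hP' : IsUnit P.det := (isUnit_iff_isUnit_det P).mp hP.isUnit
  have hQ' : IsUnit Q.det := (isUnit_iff_isUnit_det Q).mp hQ.isUnit
  have hmid : (Q - P) + (Q - P) * P⁻¹ * (Q - P) = Q * P⁻¹ * Q - Q := by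
    have hPX : P * P⁻¹ = 1 := mul_nonsing_inv P hP'
    have hXP : Q * P⁻¹ * P = Q := by rw [mul_assoc, nonsing_inv_mul P hP', mul_one]
    rw [sub_mul Q P, hPX, mul_sub, sub_mul, sub_mul, hXP, one_mul, one_mul]
    abel
  have hconj : P⁻¹ - Q⁻¹ =
      Q⁻¹ * ((Q - P) + (Q - P)ᴴ * P⁻¹ * (Q - P)) * Q⁻¹ᴴ := by
    rw [hQ.inv.isHermitian.eq, hPQ.isHermitian.eq, hmid, mul_sub,
      sub_mul, nonsing_inv_mul Q hQ', one_mul, mul_assoc Q, ← mul_assoc Q⁻¹ Q,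
      nonsing_inv_mul Q hQ', one_mul, mul_assoc P⁻¹, mul_nonsing_inv Q hQ', mul_one]
  rw [hconj]
  exact (hPQ.add (hP.inv.posSemidef.conjTranspose_mul_mul_same _)).mul_mul_conjTranspose_same _

/-- With `γ' = γ − e > 0`, in the Löwner order
`(AᵀA + γI)⁻¹ ⪯ (BᵀB + γI)⁻¹ ⪯ (γ/γ')·(AᵀA + γI)⁻¹`. -/
theorem fd_inverse_hessian_bounds
    {n m d : ℕ} (A : Matrix (Fin n) (Fin d) ℝ) (B : Matrix (Fin m) (Fin d) ℝ)
    (γ e : ℝ) (hγ : 0 < γ) (he0 : 0 ≤ e) (hγ' : 0 < γ - e)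
    (hFD₁ : (Bᵀ * B - (Aᵀ * A - e • (1 : Matrix (Fin d) (Fin d) ℝ))).PosSemidef)
    (hFD₂ : (Aᵀ * A - Bᵀ * B).PosSemidef) :
    ((Bᵀ * B + γ • (1 : Matrix (Fin d) (Fin d) ℝ))⁻¹ -
        (Aᵀ * A + γ • (1 : Matrix (Fin d) (Fin d) ℝ))⁻¹).PosSemidef ∧
      ((γ / (γ - e)) • (Aᵀ * A + γ • (1 : Matrix (Fin d) (Fin d) ℝ))⁻¹ -
        (Bᵀ * B + γ • (1 : Matrix (Fin d) (Fin d) ℝ))⁻¹).PosSemidef := by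
  have posDef_gram_add {k : ℕ} (C : Matrix (Fin k) (Fin d) ℝ) :
      (Cᵀ * C + γ • (1 : Matrix (Fin d) (Fin d) ℝ)).PosDef :=
    (PosDef.one.smul hγ).posSemidef_add (posSemidef_conjTranspose_mul_self C)
  have hA := posDef_gram_add A
  have hB := posDef_gram_add B
  refine ⟨hB.posSemidef_inv_sub_inv (by simpa using hFD₂), ?_⟩
  have hc : 0 < (γ - e) / γ := div_pos hγ' hγ
  have hinv : (γ / (γ - e)) • (Aᵀ * A + γ • (1 : Matrix (Fin d) (Fin d) ℝ))⁻¹ =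
      (((γ - e) / γ) • (Aᵀ * A + γ • (1 : Matrix (Fin d) (Fin d) ℝ)))⁻¹ := by
    refine (inv_eq_left_inv ?_).symm
    rw [smul_mul_smul_comm, nonsing_inv_mul _ ((isUnit_iff_isUnit_det _).mp hA.isUnit),
      div_mul_div_cancel₀ hγ'.ne', div_self hγ.ne', one_smul]
  rw [hinv]
  refine (hA.smul hc).posSemidef_inv_sub_inv ?_
  have hdiff : Bᵀ * B + γ • (1 : Matrix (Fin d) (Fin d) ℝ) -
      ((γ - e) / γ) • (Aᵀ * A + γ • (1 : Matrix (Fin d) (Fin d) ℝ)) =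
      (Bᵀ * B - (Aᵀ * A - e • (1 : Matrix (Fin d) (Fin d) ℝ))) + (e / γ) • (Aᵀ * A) := by
    have hγ0 := hγ.ne'
    match_scalars <;> field_simp <;> ring
  rw [hdiff]
  exact hFD₁.add ((posSemidef_conjTranspose_mul_self A).smul (div_nonneg he0 hγ.le))
end
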